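/- arXiv:2203.16668 — 2 statements merged into one kernel-verified Lean document; each statement's English description precedes it below -/
import Mathlib

section
/- Let R_p(g) := E[(r(a) − μ̂(x) − ⟨e_a − p(x), g(x,·)⟩)²]. Then f* minimizes R_p over all bounded measurable functions, i.e., R_p(f*) ≤ R_p(g) for every bounded measurable g : X×A → ℝ; moreover, for every bounded measurable h : X → ℝ, the function g(x,a) := f*(x,a) + h(x) satisfies R_p(g) = R_p(f*), so every such g is also a minimizer of R_p. -/
open MeasureTheory

/-- The R-loss risk `R_p(g) = E[(r(a) − μ̂(x) − ⟨e_a − p(x), g(x,·)⟩)²]`,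
where the data `(x, a, r)` is given by random variables `ξ, α, ρ` on `(Ω, P)`. -/
noncomputable def Rloss {X A Ω : Type*} [Fintype A] [MeasurableSpace Ω]
    (P : Measure Ω) (p : X → A → ℝ)
    (ξ : Ω → X) (α : Ω → A) (ρ : Ω → A → ℝ) (μhat : X → ℝ) (g : X → A → ℝ) : ℝ :=
  ∫ ω, (ρ ω (α ω) - μhat (ξ ω) -
      (g (ξ ω) (α ω) - ∑ a', p (ξ ω) a' * g (ξ ω) a')) ^ 2 ∂P


theorem aux_meas {X A Ω : Type*} [MeasurableSpace X] [Fintype A] [MeasurableSpace A]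
    [MeasurableSingletonClass A] [MeasurableSpace Ω] (ξ : Ω → X) (α : Ω → A)
    (hξ : Measurable ξ) (hα : Measurable α) (φ : X → A → ℝ)
    (hφ : ∀ a, Measurable fun x => φ x a) : Measurable fun ω => φ (ξ ω) (α ω) := by
  have h : Measurable (fun q : X × A => φ q.1 q.2) :=
    measurable_from_prod_countable_left (fun a => hφ a)
  exact h.comp (hξ.prodMk hα)

theorem aux_bound {A : Type*} [Fintype A] (p g : A → ℝ) (hp0 : ∀ a, 0 ≤ p a)
    (hp1 : ∑ a, p a = 1) (C : ℝ) (hg : ∀ a, |g a| ≤ C) : |∑ a, p a * g a| ≤ C := by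
  calc |∑ a, p a * g a| ≤ ∑ a, |p a * g a| := Finset.abs_sum_le_sum_abs _ _
    _ ≤ ∑ a, p a * C := by
        refine Finset.sum_le_sum fun a _ => ?_
        rw [abs_mul, abs_of_nonneg (hp0 a)]
        exact mul_le_mul_of_nonneg_left (hg a) (hp0 a)
    _ = C := by rw [← Finset.sum_mul, hp1, one_mul]

theorem fstar_minimizes_rloss
{X : Type*} [MeasurableSpace X] (ν : Measure X) [IsProbabilityMeasure ν]
    {A : Type*} [Fintype A] [Nonempty A]
    [MeasurableSpace A] [MeasurableSingletonClass A]
    -- the probability kernel `p`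
    (p : X → A → ℝ)
    (hp0 : ∀ x a, 0 ≤ p x a) (hp1 : ∀ x, ∑ a, p x a = 1)
    (hpm : ∀ a, Measurable fun x => p x a)
    -- the random triple `(x, a, r)` on a probability space `(Ω, P)`
    {Ω : Type*} [MeasurableSpace Ω] (P : Measure Ω) [IsProbabilityMeasure P]
    (ξ : Ω → X) (α : Ω → A) (ρ : Ω → A → ℝ)
    (hξ : Measurable ξ) (hα : Measurable α) (hρm : ∀ a, Measurable fun ω => ρ ω a)
    (hρ : ∀ ω a, ρ ω a ∈ Set.Icc (0 : ℝ) 1)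
    -- `f*(x,a) = E[r(a) | x]`
    (fstar : X → A → ℝ)
    (hfm : ∀ a, Measurable fun x => fstar x a)
    (hfb : ∀ x a, fstar x a ∈ Set.Icc (0 : ℝ) 1)
    (hortho : ∀ ψ : X → A → ℝ, (∀ a, Measurable fun x => ψ x a) →
      (∃ C, ∀ x a, |ψ x a| ≤ C) →
      ∫ ω, (ρ ω (α ω) - fstar (ξ ω) (α ω)) * ψ (ξ ω) (α ω) ∂P = 0)
    -- `x` has law `ν` and, conditionally on `x`, `a ∼ p(·|x)`
    (hlaw : ∀ φ : X → A → ℝ, (∀ a, Measurable fun x => φ x a) →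
      (∃ C, ∀ x a, |φ x a| ≤ C) →
      ∫ ω, φ (ξ ω) (α ω) ∂P = ∫ x, ∑ a, p x a * φ x a ∂ν)
-- the fixed nuisance estimate `μ̂`
    (μhat : X → ℝ) (hμm : Measurable μhat) (hμb : ∃ C, ∀ x, |μhat x| ≤ C) :
    (∀ g : X → A → ℝ, (∀ a, Measurable fun x => g x a) → (∃ C, ∀ x a, |g x a| ≤ C) →
      Rloss P p ξ α ρ μhat fstar ≤ Rloss P p ξ α ρ μhat g)
    ∧
    (∀ h : X → ℝ, Measurable h → (∃ C, ∀ x, |h x| ≤ C) →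
      Rloss P p ξ α ρ μhat (fun x a => fstar x a + h x) = Rloss P p ξ α ρ μhat fstar) := by
  refine ⟨?_, ?_⟩
  · rintro g hgm ⟨C, hC⟩
    obtain ⟨M, hM⟩ := hμb
    have hfb' : ∀ x a, |fstar x a| ≤ 1 := fun x a =>
      abs_le.2 ⟨by linarith [(hfb x a).1], (hfb x a).2⟩
    set S : X → ℝ := fun x => ∑ a', p x a' * fstar x a' with hS
    set G : X → ℝ := fun x => ∑ a', p x a' * g x a' with hG
    have hSm : Measurable S := Finset.measurable_fun_sum _ fun a _ => (hpm a).mul (hfm a)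
    have hGm : Measurable G := Finset.measurable_fun_sum _ fun a _ => (hpm a).mul (hgm a)
    have hSb : ∀ x, |S x| ≤ 1 := fun x => aux_bound _ _ (hp0 x) (hp1 x) 1 (hfb' x)
    have hGb : ∀ x, |G x| ≤ C := fun x => aux_bound _ _ (hp0 x) (hp1 x) C (hC x)
    set W : X → A → ℝ := fun x a => (fstar x a - S x) - (g x a - G x) with hW
    have hWm : ∀ a, Measurable fun x => W x a := fun a =>
      ((hfm a).sub hSm).sub ((hgm a).sub hGm)
    have hWb : ∀ x a, |W x a| ≤ 2 + 2 * C := by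
      intro x a
      have h1 := abs_le.1 (hfb' x a)
      have h2 := abs_le.1 (hSb x)
      have h3 := abs_le.1 (hC x a)
      have h4 := abs_le.1 (hGb x)
      exact abs_le.2 ⟨by simp only [hW]; linarith, by simp only [hW]; linarith⟩
    have hW0 : ∀ x, ∑ a, p x a * W x a = 0 := by
      intro x
      simp only [hW, mul_sub, Finset.sum_sub_distrib, ← Finset.sum_mul, hp1]
      simp only [hS, hG]; ring
    have e1 := hortho W hWm ⟨_, hWb⟩
    have e2 : ∫ ω, (S (ξ ω) - μhat (ξ ω)) * W (ξ ω) (α ω) ∂P = 0 := by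
      rw [hlaw (fun x a => (S x - μhat x) * W x a) (fun a => (hSm.sub hμm).mul (hWm a))
        ⟨(1 + M) * (2 + 2 * C), fun x a => ?_⟩]
      · have : ∀ x, ∑ a, p x a * ((S x - μhat x) * W x a) = 0 := fun x => by
          have : ∀ a, p x a * ((S x - μhat x) * W x a) = (S x - μhat x) * (p x a * W x a) :=
            fun a => by ring
          simp only [this, ← Finset.mul_sum, hW0, mul_zero]
        simp [this]
      · rw [abs_mul]
        have h5 : |S x - μhat x| ≤ 1 + M :=
          (abs_sub _ _).trans (add_le_add (hSb x) (hM x))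
        exact mul_le_mul h5 (hWb x a) (abs_nonneg _) ((abs_nonneg _).trans h5)
    have mρ : Measurable fun ω => ρ ω (α ω) :=
      aux_meas (fun ω => ω) α measurable_id hα ρ hρm
    have mf := aux_meas ξ α hξ hα fstar hfm
    have mW := aux_meas ξ α hξ hα W hWm
    have mS := hSm.comp hξ
    have mμ := hμm.comp hξ
    have bd : ∀ (u : Ω → ℝ) (B : ℝ), Measurable u → (∀ ω, |u ω| ≤ B) → MemLp u 2 P :=
      fun u B hu hb => MemLp.of_bound hu.aestronglyMeasurable B (Filter.Eventually.of_forall hb)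
    have lρ : MemLp (fun ω => ρ ω (α ω)) 2 P := bd _ 1 mρ fun ω =>
      abs_le.2 ⟨by linarith [(hρ ω (α ω)).1], (hρ ω (α ω)).2⟩
    have lf : MemLp (fun ω => fstar (ξ ω) (α ω)) 2 P := bd _ 1 mf fun ω => hfb' _ _
    have lW : MemLp (fun ω => W (ξ ω) (α ω)) 2 P := bd _ _ mW fun ω => hWb _ _
    have lS : MemLp (fun ω => S (ξ ω)) 2 P := bd _ _ mS fun ω => hSb _
    have lμ : MemLp (fun ω => μhat (ξ ω)) 2 P := bd _ _ mμ fun ω => hM _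
    have i1 : Integrable (fun ω => (ρ ω (α ω) - fstar (ξ ω) (α ω)) * W (ξ ω) (α ω)) P :=
      (lρ.sub lf).integrable_mul lW
    have i2 : Integrable (fun ω => (S (ξ ω) - μhat (ξ ω)) * W (ξ ω) (α ω)) P :=
      (lS.sub lμ).integrable_mul lW
    have i3 : Integrable (fun ω => (ρ ω (α ω) - μhat (ξ ω) -
        (fstar (ξ ω) (α ω) - S (ξ ω))) ^ 2) P :=
      ((lρ.sub lμ).sub (lf.sub lS)).integrable_sq
    have i4 : Integrable (fun ω => W (ξ ω) (α ω) ^ 2) P := lW.integrable_sq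
    have key : Rloss P p ξ α ρ μhat g = Rloss P p ξ α ρ μhat fstar
        + ∫ ω, W (ξ ω) (α ω) ^ 2 ∂P := by
      have : Rloss P p ξ α ρ μhat g = ∫ ω, (((ρ ω (α ω) - μhat (ξ ω) -
          (fstar (ξ ω) (α ω) - S (ξ ω))) ^ 2 + W (ξ ω) (α ω) ^ 2)
          + 2 * ((ρ ω (α ω) - fstar (ξ ω) (α ω)) * W (ξ ω) (α ω)
            + (S (ξ ω) - μhat (ξ ω)) * W (ξ ω) (α ω))) ∂P := by
        unfold Rloss
        refine integral_congr_ae (Filter.Eventually.of_forall fun ω => ?_)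
        change (ρ ω (α ω) - μhat (ξ ω) - (g (ξ ω) (α ω) - G (ξ ω))) ^ 2 = _
        simp only [hW]; ring
      rw [this, integral_add (by exact i3.add i4) (by exact (i1.add i2).const_mul 2), integral_add i3 i4,
        integral_const_mul, integral_add i1 i2, e1, e2]
      simp [Rloss, hS]
    rw [key]
    have : 0 ≤ ∫ ω, W (ξ ω) (α ω) ^ 2 ∂P := integral_nonneg fun ω => sq_nonneg _
    linarith
  · intro h _ _
    unfold Rloss
    congr 1
    funext ω
    simp only [mul_add, Finset.sum_add_distrib, ← Finset.sum_mul, hp1]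
    ring
end

section
/- Let p̂ be another measurable assignment of a vector p̂(·|x) ∈ ℝ^A to each x ∈ X, with R_{p,p̂}(g) := E[(r(a) − μ̂(x) − ⟨e_a − p̂(x), g(x,·)⟩)²] and R_p(g) := E[(r(a) − μ̂(x) − ⟨e_a − p(x), g(x,·)⟩)²]. Then for any measurable g, g* : X×A → [0,1], writing ‖·‖ for the Euclidean norm on ℝ^A, |(R_{p,p̂}(g) − R_{p,p̂}(g*)) − (R_p(g) − R_p(g*))| ≤ 2(1 + √K) · (E_{x∼ν}[‖g(x,·) − g*(x,·)‖²])^{1/2} · ((E_{x∼ν}[‖p(·|x) − p̂(·|x)‖⁴])^{1/2} + (E_{x∼ν}[(μ(x) − μ̂(x))² ‖p(·|x) − p̂(·|x)‖²])^{1/2}), where μ(x) := Σ_{a∈A} p(a|x) f*(x,a). -/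
open MeasureTheory

def BddMeas {X : Type*} [MeasurableSpace X] (f : X → ℝ) : Prop :=
  Measurable f ∧ ∃ C, ∀ x, |f x| ≤ C

namespace BddMeas
variable {X : Type*} [MeasurableSpace X] {f g : X → ℝ}

theorem const (c : ℝ) : BddMeas (fun _ : X => c) := ⟨measurable_const, |c|, fun _ => le_rfl⟩

theorem add (hf : BddMeas f) (hg : BddMeas g) : BddMeas (fun x => f x + g x) := by
  obtain ⟨h1, C, h2⟩ := hf
  obtain ⟨h3, D, h4⟩ := hg
  exact ⟨h1.add h3, C + D, fun x => (abs_add_le _ _).trans (add_le_add (h2 x) (h4 x))⟩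

theorem mul (hf : BddMeas f) (hg : BddMeas g) : BddMeas (fun x => f x * g x) := by
  obtain ⟨h1, C, h2⟩ := hf
  obtain ⟨h3, D, h4⟩ := hg
  refine ⟨h1.mul h3, C * D, fun x => ?_⟩
  rw [abs_mul]
  exact mul_le_mul (h2 x) (h4 x) (abs_nonneg _) ((abs_nonneg _).trans (h2 x))

theorem sub (hf : BddMeas f) (hg : BddMeas g) : BddMeas (fun x => f x - g x) := by
  have := hf.add ((const (-1)).mul hg)
  simpa [sub_eq_add_neg] using this

theorem sq (hf : BddMeas f) : BddMeas (fun x => f x ^ 2) := by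
  simpa [pow_two] using hf.mul hf

theorem sum {A : Type*} (s : Finset A) {F : A → X → ℝ} (h : ∀ a, BddMeas (F a)) :
    BddMeas (fun x => ∑ a ∈ s, F a x) := by
  classical
  induction s using Finset.induction_on with
  | empty => simpa using const 0
  | insert a s ha ih => simpa [Finset.sum_insert ha] using (h a).add ih

theorem sqrt (hf : BddMeas f) : BddMeas (fun x => Real.sqrt (f x)) := by
  obtain ⟨h1, C, h2⟩ := hf
  refine ⟨h1.sqrt, Real.sqrt C, fun x => ?_⟩
  rw [abs_of_nonneg (Real.sqrt_nonneg _)]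
  exact Real.sqrt_le_sqrt ((le_abs_self _).trans (h2 x))

theorem abs (hf : BddMeas f) : BddMeas (fun x => |f x|) := by
  obtain ⟨h1, C, h2⟩ := hf
  exact ⟨h1.abs, C, fun x => by simpa using h2 x⟩

theorem comp {Ω : Type*} [MeasurableSpace Ω] (hf : BddMeas f) {ξ : Ω → X} (hξ : Measurable ξ) :
    BddMeas (fun ω => f (ξ ω)) := by
  obtain ⟨h1, C, h2⟩ := hf
  exact ⟨h1.comp hξ, C, fun ω => h2 _⟩

theorem unif {A : Type*} [Fintype A] {F : X → A → ℝ} (h : ∀ a, BddMeas (fun x => F x a)) :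
    ∃ C, ∀ x a, |F x a| ≤ C := by
  obtain ⟨-, C, hC⟩ := sum Finset.univ (fun a => (h a).abs)
  refine ⟨C, fun x a => le_trans ?_ ((le_abs_self _).trans (hC x))⟩
  exact Finset.single_le_sum (f := fun a => |F x a|) (fun i _ => abs_nonneg _) (Finset.mem_univ a)

theorem eval {A : Type*} [Fintype A] [MeasurableSpace A] [MeasurableSingletonClass A]
    {F : X → A → ℝ} (h : ∀ a, BddMeas (fun x => F x a)) {α : X → A} (hα : Measurable α) :
    BddMeas (fun x => F x (α x)) := by
  obtain ⟨C, hC⟩ := unif h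
  refine ⟨?_, C, fun x => hC x _⟩
  have : Measurable (fun q : X × A => F q.1 q.2) :=
    measurable_from_prod_countable_left (fun a => (h a).1)
  exact this.comp (measurable_id.prodMk hα)

theorem integrable (hf : BddMeas f) (μ : Measure X) [IsProbabilityMeasure μ] :
    Integrable f μ := by
  obtain ⟨h1, C, h2⟩ := hf
  exact Integrable.of_bound h1.aestronglyMeasurable C (Filter.Eventually.of_forall h2)

theorem cauchy (hf : BddMeas f) (hg : BddMeas g) (hf0 : ∀ x, 0 ≤ f x) (hg0 : ∀ x, 0 ≤ g x)
    (μ : Measure X) [IsProbabilityMeasure μ] :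
    ∫ x, f x * g x ∂μ ≤ Real.sqrt (∫ x, f x ^ 2 ∂μ) * Real.sqrt (∫ x, g x ^ 2 ∂μ) := by
  obtain ⟨h1, C, h2⟩ := hf
  obtain ⟨h3, D, h4⟩ := hg
  have := integral_mul_le_Lp_mul_Lq_of_nonneg (μ := μ) Real.HolderConjugate.two_two
    (Filter.Eventually.of_forall hf0) (Filter.Eventually.of_forall hg0)
    (MemLp.of_bound h1.aestronglyMeasurable C (Filter.Eventually.of_forall h2))
    (MemLp.of_bound h3.aestronglyMeasurable D (Filter.Eventually.of_forall h4))
  simpa [Real.sqrt_eq_rpow] using this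

end BddMeas

theorem Rloss_diff
    {X : Type*} [MeasurableSpace X] (ν : Measure X)
    {A : Type*} [Fintype A]
    [MeasurableSpace A] [MeasurableSingletonClass A]
    (p : X → A → ℝ) (hp1 : ∀ x, ∑ a, p x a = 1)
    (hp : ∀ a, BddMeas fun x => p x a)
    {Ω : Type*} [MeasurableSpace Ω] (P : Measure Ω) [IsProbabilityMeasure P]
    (ξ : Ω → X) (α : Ω → A) (ρ : Ω → A → ℝ)
    (hξ : Measurable ξ) (hα : Measurable α) (hρ : ∀ a, BddMeas fun ω => ρ ω a)
    (fstar : X → A → ℝ)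
    (hf : ∀ a, BddMeas fun x => fstar x a)
    (hortho : ∀ ψ : X → A → ℝ, (∀ a, Measurable fun x => ψ x a) →
      (∃ C, ∀ x a, |ψ x a| ≤ C) →
      ∫ ω, (ρ ω (α ω) - fstar (ξ ω) (α ω)) * ψ (ξ ω) (α ω) ∂P = 0)
    (hlaw : ∀ φ : X → A → ℝ, (∀ a, Measurable fun x => φ x a) →
      (∃ C, ∀ x a, |φ x a| ≤ C) →
      ∫ ω, φ (ξ ω) (α ω) ∂P = ∫ x, ∑ a, p x a * φ x a ∂ν)
    (μhat : X → ℝ) (hμ : BddMeas μhat)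
    (phat : X → A → ℝ) (hph : ∀ a, BddMeas fun x => phat x a)
    (g : X → A → ℝ) (hg : ∀ a, BddMeas fun x => g x a) :
    Rloss P phat ξ α ρ μhat g - Rloss P p ξ α ρ μhat g =
      ∫ x, (2 * ((∑ a, p x a * fstar x a) - μhat x) * (∑ a, (phat x a - p x a) * g x a)
        + (∑ a, (phat x a - p x a) * g x a) ^ 2) ∂ν := by
  have hS : ∀ q : X → A → ℝ, (∀ a, BddMeas fun x => q x a) →
      BddMeas (fun x => ∑ a, q x a * g x a) :=
    fun q hq => BddMeas.sum _ (fun a => (hq a).mul (hg a))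
  have hY : BddMeas (fun ω => ρ ω (α ω) - μhat (ξ ω)) :=
    (BddMeas.eval hρ hα).sub (hμ.comp hξ)
  have hG : BddMeas (fun ω => g (ξ ω) (α ω)) :=
    BddMeas.eval (F := fun ω a => g (ξ ω) a) (fun a => (hg a).comp hξ) hα
  have hF : BddMeas (fun ω => fstar (ξ ω) (α ω)) :=
    BddMeas.eval (F := fun ω a => fstar (ξ ω) a) (fun a => (hf a).comp hξ) hα
  have hI : ∀ q : X → A → ℝ, (∀ a, BddMeas fun x => q x a) →
      BddMeas (fun ω => (ρ ω (α ω) - μhat (ξ ω) -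
      (g (ξ ω) (α ω) - ∑ a', q (ξ ω) a' * g (ξ ω) a')) ^ 2) :=
    fun q hq => (hY.sub (hG.sub ((hS q hq).comp hξ))).sq
  set w : X → ℝ := fun x => ∑ a, (phat x a - p x a) * g x a with hw
  have hwB : BddMeas w := hS (fun x a => phat x a - p x a) (fun a => (hph a).sub (hp a))
  have hwe : ∀ x, ∑ a, phat x a * g x a = (∑ a, p x a * g x a) + w x := by
    intro x
    simp only [hw, sub_mul, Finset.sum_sub_distrib]; ring
  let ψ : X → A → ℝ := fun x _ => 2 * w x
  let φ : X → A → ℝ := fun x a =>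
    2 * (fstar x a - μhat x - (g x a - ∑ a', p x a' * g x a')) * w x + w x ^ 2
  have hψB : ∀ a, BddMeas (fun x => ψ x a) := fun a => (BddMeas.const 2).mul hwB
  have hφB : ∀ a, BddMeas (fun x => φ x a) := fun a =>
    (((BddMeas.const 2).mul (((hf a).sub hμ).sub ((hg a).sub (hS p hp)))).mul hwB).add hwB.sq
  have h1 := hortho ψ (fun a => (hψB a).1) (BddMeas.unif hψB)
  have h2 := hlaw φ (fun a => (hφB a).1) (BddMeas.unif hφB)
  have hA : BddMeas (fun ω => (ρ ω (α ω) - fstar (ξ ω) (α ω)) * ψ (ξ ω) (α ω)) :=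
    ((BddMeas.eval hρ hα).sub hF).mul ((BddMeas.const 2).mul (hwB.comp hξ))
  have hB : BddMeas (fun ω => φ (ξ ω) (α ω)) :=
    BddMeas.eval (F := fun ω a => φ (ξ ω) a) (fun a => (hφB a).comp hξ) hα
  unfold Rloss
  rw [← integral_sub ((hI phat hph).integrable P) ((hI p hp).integrable P)]
  calc _ = ∫ ω, ((ρ ω (α ω) - fstar (ξ ω) (α ω)) * ψ (ξ ω) (α ω) + φ (ξ ω) (α ω)) ∂P := by
        congr 1; ext ω
        simp only [hwe, ψ, φ]; ring
    _ = ∫ x, ∑ a, p x a * φ x a ∂ν := by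
        rw [integral_add (hA.integrable P) (hB.integrable P), h1, h2, zero_add]
    _ = _ := by
        congr 1; ext x
        have e : ∀ a, p x a * φ x a = 2 * w x * (p x a * fstar x a) - 2 * w x * (p x a * g x a)
            + (2 * w x * (-μhat x + ∑ a', p x a' * g x a') + w x ^ 2) * p x a := by
          intro a; simp only [φ]; ring
        simp only [e, Finset.sum_add_distrib, Finset.sum_sub_distrib, ← Finset.mul_sum, hp1]
        ring

theorem pointwise_bound {A : Type*} [Fintype A] (M : ℝ) (d g k : A → ℝ)
    (hg : ∀ a, g a ∈ Set.Icc (0 : ℝ) 1) (hk : ∀ a, k a ∈ Set.Icc (0 : ℝ) 1) :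
    |(2 * M * (∑ a, d a * g a) + (∑ a, d a * g a) ^ 2) -
      (2 * M * (∑ a, d a * k a) + (∑ a, d a * k a) ^ 2)| ≤
    2 * (Real.sqrt (∑ a, (g a - k a) ^ 2) * (|M| * Real.sqrt (∑ a, d a ^ 2)))
    + 2 * Real.sqrt (Fintype.card A) *
      (Real.sqrt (∑ a, (g a - k a) ^ 2) * (∑ a, d a ^ 2)) := by
  have cs : ∀ u : A → ℝ, |∑ a, d a * u a| ≤
      Real.sqrt (∑ a, d a ^ 2) * Real.sqrt (∑ a, u a ^ 2) := by
    intro u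
    rw [← Real.sqrt_mul (Finset.sum_nonneg fun a _ => sq_nonneg _)]
    exact Real.abs_le_sqrt (Finset.sum_mul_sq_le_sq_mul_sq _ _ _)
  have h1 := cs (fun a => g a - k a)
  have h2 := cs (fun a => g a + k a)
  have h3 : Real.sqrt (∑ a, (g a + k a) ^ 2) ≤ 2 * Real.sqrt (Fintype.card A) := by
    rw [show (2 : ℝ) = Real.sqrt 4 by
      rw [show (4 : ℝ) = 2 ^ 2 by norm_num]; exact (Real.sqrt_sq (by norm_num)).symm,
      ← Real.sqrt_mul (by norm_num)]
    apply Real.sqrt_le_sqrt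
    calc _ ≤ ∑ a : A, (4 : ℝ) := Finset.sum_le_sum fun a _ => by
          nlinarith [(hg a).1, (hg a).2, (hk a).1, (hk a).2]
      _ = _ := by simp [mul_comm]
  have hd : Real.sqrt (∑ a, d a ^ 2) * Real.sqrt (∑ a, d a ^ 2) = ∑ a, d a ^ 2 :=
    Real.mul_self_sqrt (Finset.sum_nonneg fun a _ => sq_nonneg _)
  have hD0 := Real.sqrt_nonneg (∑ a, d a ^ 2)
  have hH0 := Real.sqrt_nonneg (∑ a, (g a - k a) ^ 2)
  have e : (2 * M * (∑ a, d a * g a) + (∑ a, d a * g a) ^ 2) -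
      (2 * M * (∑ a, d a * k a) + (∑ a, d a * k a) ^ 2) =
      2 * M * (∑ a, d a * (g a - k a)) +
      (∑ a, d a * (g a - k a)) * (∑ a, d a * (g a + k a)) := by
    simp only [mul_sub, mul_add, Finset.sum_sub_distrib, Finset.sum_add_distrib]; ring
  rw [e]
  set D := Real.sqrt (∑ a, d a ^ 2)
  set H := Real.sqrt (∑ a, (g a - k a) ^ 2)
  have h4 := h2.trans (mul_le_mul_of_nonneg_left h3 hD0)
  calc _ ≤ 2 * |M| * |∑ a, d a * (g a - k a)| +
        |∑ a, d a * (g a - k a)| * |∑ a, d a * (g a + k a)| := by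
        refine (abs_add_le _ _).trans (le_of_eq ?_)
        simp [abs_mul]
    _ ≤ 2 * |M| * (D * H) + (D * H) * (D * (2 * Real.sqrt (Fintype.card A))) := by gcongr
    _ = _ := by rw [← hd]; ring

theorem approximate_rloss_excess_risk_error_bound
    {X : Type*} [MeasurableSpace X] (ν : Measure X) [IsProbabilityMeasure ν]
    {A : Type*} [Fintype A] [Nonempty A]
    [MeasurableSpace A] [MeasurableSingletonClass A]
    -- the probability kernel `p`
    (p : X → A → ℝ)
    (hp0 : ∀ x a, 0 ≤ p x a) (hp1 : ∀ x, ∑ a, p x a = 1)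
    (hpm : ∀ a, Measurable fun x => p x a)
    -- the random triple `(x, a, r)` on a probability space `(Ω, P)`
    {Ω : Type*} [MeasurableSpace Ω] (P : Measure Ω) [IsProbabilityMeasure P]
    (ξ : Ω → X) (α : Ω → A) (ρ : Ω → A → ℝ)
    (hξ : Measurable ξ) (hα : Measurable α) (hρm : ∀ a, Measurable fun ω => ρ ω a)
    (hρ : ∀ ω a, ρ ω a ∈ Set.Icc (0 : ℝ) 1)
    -- `f*(x,a) = E[r(a) | x]`
    (fstar : X → A → ℝ)
    (hfm : ∀ a, Measurable fun x => fstar x a)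
    (hfb : ∀ x a, fstar x a ∈ Set.Icc (0 : ℝ) 1)
    (hortho : ∀ ψ : X → A → ℝ, (∀ a, Measurable fun x => ψ x a) →
      (∃ C, ∀ x a, |ψ x a| ≤ C) →
      ∫ ω, (ρ ω (α ω) - fstar (ξ ω) (α ω)) * ψ (ξ ω) (α ω) ∂P = 0)
    -- `x` has law `ν` and, conditionally on `x`, `a ∼ p(·|x)`
    (hlaw : ∀ φ : X → A → ℝ, (∀ a, Measurable fun x => φ x a) →
      (∃ C, ∀ x a, |φ x a| ≤ C) →
      ∫ ω, φ (ξ ω) (α ω) ∂P = ∫ x, ∑ a, p x a * φ x a ∂ν)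
    -- the fixed nuisance estimate `μ̂`
    (μhat : X → ℝ) (hμm : Measurable μhat) (hμb : ∃ C, ∀ x, |μhat x| ≤ C)
    -- the estimated propensity kernel
    (phat : X → A → ℝ)
    (hphm : ∀ a, Measurable fun x => phat x a) (hphb : ∃ C, ∀ x a, |phat x a| ≤ C) :
    ∀ g gstar : X → A → ℝ,
      (∀ a, Measurable fun x => g x a) → (∀ x a, g x a ∈ Set.Icc (0 : ℝ) 1) →
      (∀ a, Measurable fun x => gstar x a) → (∀ x a, gstar x a ∈ Set.Icc (0 : ℝ) 1) →
      |(Rloss P phat ξ α ρ μhat g - Rloss P phat ξ α ρ μhat gstar)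
          - (Rloss P p ξ α ρ μhat g - Rloss P p ξ α ρ μhat gstar)|
        ≤ 2 * (1 + Real.sqrt (Fintype.card A))
            * Real.sqrt (∫ x, ∑ a, (g x a - gstar x a) ^ 2 ∂ν)
            * (Real.sqrt (∫ x, (∑ a, (p x a - phat x a) ^ 2) ^ 2 ∂ν)
              + Real.sqrt (∫ x, ((∑ a, p x a * fstar x a) - μhat x) ^ 2
                  * ∑ a, (p x a - phat x a) ^ 2 ∂ν)) := by
  intro g k hgm hgb hkm hkb
  have icc : ∀ {Y : Type _} [MeasurableSpace Y] (F : Y → A → ℝ), (∀ a, Measurable fun x => F x a) →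
      (∀ x a, F x a ∈ Set.Icc (0 : ℝ) 1) → ∀ a, BddMeas (fun x => F x a) :=
    fun F h1 h2 a => ⟨h1 a, 1, fun x => abs_le.2 ⟨by linarith [(h2 x a).1], (h2 x a).2⟩⟩
  have hg : ∀ a, BddMeas (fun x => g x a) := icc g hgm hgb
  have hk : ∀ a, BddMeas (fun x => k x a) := icc k hkm hkb
  have hf : ∀ a, BddMeas (fun x => fstar x a) := icc fstar hfm hfb
  have hp : ∀ a, BddMeas (fun x => p x a) := icc p hpm fun x a =>
    ⟨hp0 x a, by rw [← hp1 x]; exact Finset.single_le_sum (fun i _ => hp0 x i) (Finset.mem_univ a)⟩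
  have hr : ∀ a, BddMeas (fun ω => ρ ω a) := fun a =>
    ⟨hρm a, 1, fun x => abs_le.2 ⟨by linarith [(hρ x a).1], (hρ x a).2⟩⟩
  have hph : ∀ a, BddMeas (fun x => phat x a) := fun a =>
    ⟨hphm a, hphb.imp fun C h x => h x a⟩
  have hμ : BddMeas μhat := ⟨hμm, hμb⟩
  have Eg := Rloss_diff ν p hp1 hp P ξ α ρ hξ hα hr fstar hf hortho hlaw μhat hμ phat hph g hg
  have Ek := Rloss_diff ν p hp1 hp P ξ α ρ hξ hα hr fstar hf hortho hlaw μhat hμ phat hph k hk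
  have hM : BddMeas (fun x => (∑ a, p x a * fstar x a) - μhat x) :=
    (BddMeas.sum _ fun a => (hp a).mul (hf a)).sub hμ
  have hW : ∀ u : X → A → ℝ, (∀ a, BddMeas fun x => u x a) → BddMeas (fun x =>
      (2 * ((∑ a, p x a * fstar x a) - μhat x) * (∑ a, (phat x a - p x a) * u x a)
        + (∑ a, (phat x a - p x a) * u x a) ^ 2)) := fun u hu => by
    have h := BddMeas.sum Finset.univ fun a => ((hph a).sub (hp a)).mul (hu a)
    exact (((BddMeas.const 2).mul hM).mul h).add h.sq
  have hD : BddMeas (fun x => ∑ a, (phat x a - p x a) ^ 2) :=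
    BddMeas.sum _ fun a => ((hph a).sub (hp a)).sq
  have hH : BddMeas (fun x => Real.sqrt (∑ a, (g x a - k x a) ^ 2)) :=
    (BddMeas.sum _ fun a => ((hg a).sub (hk a)).sq).sqrt
  have hH2 : ∀ x, Real.sqrt (∑ a, (g x a - k x a) ^ 2) ^ 2 = ∑ a, (g x a - k x a) ^ 2 :=
    fun x => Real.sq_sqrt (Finset.sum_nonneg fun a _ => sq_nonneg _)
  have hD2 : ∀ x, Real.sqrt (∑ a, (phat x a - p x a) ^ 2) ^ 2 = ∑ a, (phat x a - p x a) ^ 2 :=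
    fun x => Real.sq_sqrt (Finset.sum_nonneg fun a _ => sq_nonneg _)
  have c1 := BddMeas.cauchy hH (hM.abs.mul hD.sqrt) (fun x => Real.sqrt_nonneg _)
    (fun x => mul_nonneg (abs_nonneg _) (Real.sqrt_nonneg _)) ν
  have c2 := BddMeas.cauchy hH hD (fun x => Real.sqrt_nonneg _)
    (fun x => Finset.sum_nonneg fun a _ => sq_nonneg _) ν
  simp only [mul_pow, hH2, hD2, sq_abs] at c1 c2
  have i1 := (hH.mul (hM.abs.mul hD.sqrt)).integrable ν
  have i2 := (hH.mul hD).integrable ν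
  have sw : ∀ x a, (p x a - phat x a) ^ 2 = (phat x a - p x a) ^ 2 := fun x a => by ring
  simp only [sw]
  have key : |(Rloss P phat ξ α ρ μhat g - Rloss P phat ξ α ρ μhat k)
          - (Rloss P p ξ α ρ μhat g - Rloss P p ξ α ρ μhat k)| ≤
      2 * (∫ x, Real.sqrt (∑ a, (g x a - k x a) ^ 2) *
        (|(∑ a, p x a * fstar x a) - μhat x| * Real.sqrt (∑ a, (phat x a - p x a) ^ 2)) ∂ν)
      + 2 * Real.sqrt (Fintype.card A) * (∫ x, Real.sqrt (∑ a, (g x a - k x a) ^ 2) *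
          (∑ a, (phat x a - p x a) ^ 2) ∂ν) := by
    rw [sub_sub_sub_comm, Eg, Ek, ← integral_sub ((hW g hg).integrable ν) ((hW k hk).integrable ν),
      ← integral_const_mul, ← integral_const_mul,
      ← integral_add (i1.const_mul _) (i2.const_mul _)]
    refine abs_integral_le_integral_abs.trans (integral_mono
      (((hW g hg).sub (hW k hk)).abs.integrable ν) ((i1.const_mul _).add (i2.const_mul _)) ?_)
    intro x
    exact pointwise_bound _ (fun a => phat x a - p x a) (g x) (k x) (hgb x) (hkb x)
  refine key.trans ?_
  have n1 := Real.sqrt_nonneg (Fintype.card A : ℝ)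
  have nH := Real.sqrt_nonneg (∫ x, ∑ a, (g x a - k x a) ^ 2 ∂ν)
  have nD := Real.sqrt_nonneg (∫ x, (∑ a, (phat x a - p x a) ^ 2) ^ 2 ∂ν)
  have nE := Real.sqrt_nonneg (∫ x, ((∑ a, p x a * fstar x a) - μhat x) ^ 2
                  * ∑ a, (phat x a - p x a) ^ 2 ∂ν)
  have t2 := mul_le_mul_of_nonneg_left c2 n1
  have m1 := mul_nonneg nH nD
  have m2 := mul_nonneg n1 (mul_nonneg nH nE)
  nlinarith
end
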